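/- Let p be a prime and n a positive integer such that either p ≥ 3 and n ≥ 2, or p ≥ 5 and n ≥ 1. Then the cyclic group ℤ/p^nℤ does not have property L_p. -/

import Mathlib

/-- The natural reduction ring homomorphism `W₂(k) → k` from length-two `p`-typical
Witt vectors to `k`, given by the zeroth coefficient. -/
noncomputable def wittReduce (p : ℕ) [Fact p.Prime] (k : Type*) [CommRing k] :
    TruncatedWittVector p 2 k →+* k :=
  RingHom.liftOfRightInverse (WittVector.truncate 2) TruncatedWittVector.out
    TruncatedWittVector.truncateFun_out
    ⟨WittVector.constantCoeff, fun x hx => by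
      rw [WittVector.mem_ker_truncate] at hx
      simpa [RingHom.mem_ker] using hx 0 (by norm_num)⟩

/-- A finite group `G` has property `L_p` if every homomorphism `G → GL_n(k)`, for `k` a
finite field of characteristic `p`, lifts to `GL_n(W₂(k))`. -/
def HasLp (p : ℕ) [Fact p.Prime] (G : Type*) [Group G] : Prop :=
  ∀ (n : ℕ), 1 ≤ n → ∀ (k : Type) [Field k] [Fintype k] [CharP k p],
    ∀ f : G →* GL (Fin n) k,
      ∃ g : G →* GL (Fin n) (TruncatedWittVector p 2 k),
        (Matrix.GeneralLinearGroup.map (wittReduce p k)).comp g = f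

/-- A group has property `L` if it has property `L_p` for every prime `p`. -/
def HasL (G : Type*) [Group G] : Prop :=
  ∀ (p : ℕ) [Fact p.Prime], HasLp p G

theorem wittReduce_truncate (p : ℕ) [Fact p.Prime] {k : Type*} [CommRing k]
    (x : WittVector p k) : wittReduce p k (WittVector.truncate 2 x) = x.coeff 0 :=
  RingHom.liftOfRightInverse_comp_apply _ _ _ _ _

theorem natCast_sq_truncatedWittVector_two (p : ℕ) [Fact p.Prime] {k : Type*} [CommRing k]
    [CharP k p] : (p : TruncatedWittVector p 2 k) ^ 2 = 0 := by
  have h : WittVector.truncate 2 ((p : WittVector p k) ^ 2) = 0 := by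
    rw [← RingHom.mem_ker, WittVector.mem_ker_truncate]
    intro i hi
    exact WittVector.coeff_p_pow_eq_zero p k hi.ne
  simpa using h

/-- Over `𝔽_p`, the kernel of the reduction is generated by `p`. -/
theorem exists_eq_natCast_mul_of_wittReduce_eq_zero {p : ℕ} [Fact p.Prime]
    {w : TruncatedWittVector p 2 (ZMod p)} (hw : wittReduce p (ZMod p) w = 0) :
    ∃ v, w = p * v := by
  obtain ⟨x, rfl⟩ := WittVector.truncate_surjective p 2 (ZMod p) w
  rw [wittReduce_truncate] at hw
  obtain ⟨y, rfl⟩ : ∃ y, x = WittVector.verschiebung y :=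
    ⟨x.shift 1, by
      rw [WittVector.verschiebung_shift x 0 (by simpa using hw)]
      ext i
      simp [WittVector.shift_coeff]⟩
  exact ⟨WittVector.truncate 2 y, by rw [WittVector.verschiebung_zmod, map_mul, map_natCast,
    mul_comm]⟩

theorem wittReduce_eq_zero_of_natCast_mul_eq_zero {p : ℕ} [Fact p.Prime] {k : Type*} [Field k]
    [CharP k p] {w : TruncatedWittVector p 2 k} (hw : p * w = 0) :
    wittReduce p k w = 0 := by
  obtain ⟨x, rfl⟩ := WittVector.truncate_surjective p 2 k w
  rw [wittReduce_truncate]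
  have h : WittVector.truncate 2 (x * (p : WittVector p k)) = 0 := by
    rw [map_mul, map_natCast, mul_comm, hw]
  rw [← RingHom.mem_ker, WittVector.mem_ker_truncate] at h
  have h1 := h 1 one_lt_two
  rw [WittVector.mul_charP_coeff_succ] at h1
  exact pow_eq_zero_iff (Fact.out : p.Prime).ne_zero |>.mp h1

theorem one_add_pow_prime_eq_of_mul_sq_eq_zero {A : Type*} [CommRing A] {p : ℕ} (hp : p.Prime)
    {z : A} (hz : p * z ^ 2 = 0) : (1 + z) ^ p = 1 + p * z + z ^ p := by
  obtain ⟨t, rfl⟩ := Nat.exists_eq_add_of_le' hp.two_le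
  rw [add_comm 1 z, add_pow, Finset.sum_range_succ, Finset.sum_range_succ',
    Finset.sum_range_succ', Finset.sum_eq_zero]
  · simp
    ring
  · intro i hi
    obtain ⟨c, hc⟩ := hp.dvd_choose_self (k := i + 2) (by omega)
      (by have := Finset.mem_range.mp hi; omega)
    rw [show i + 1 + 1 = i + 2 from rfl, hc, Nat.cast_mul]
    linear_combination z ^ i * 1 ^ (t + 2 - (i + 2)) * c * hz

theorem one_add_pow_prime_pow_eq {A : Type*} [CommRing A] {p m : ℕ} (hp : p.Prime)
    (h : 2 * p ^ m + 2 ≤ p ^ m * p) {x : A} (h0 : (p : A) ^ 2 = 0)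
    (h1 : p * x ^ (p ^ m + 1) = 0) (h2 : x ^ (2 * p ^ m + 2) = 0) :
    (1 + x) ^ p ^ (m + 1) = 1 + p * x ^ p ^ m := by
  obtain ⟨b, hb⟩ := exists_add_pow_prime_pow_eq hp 1 x m
  set z := x ^ p ^ m + p * x * b with hz
  have hq : x ^ p ^ m = x * x ^ (p ^ m - 1) := by
    rw [← pow_succ', Nat.sub_add_cancel (Nat.one_le_pow _ _ hp.pos)]
  have hpz : (p : A) * z = p * x ^ p ^ m := by
    linear_combination x * b * h0
  have hmul (k : ℕ) (hk : 1 ≤ k) : (x ^ p ^ m) ^ k * z = (x ^ p ^ m) ^ (k + 1) := by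
    obtain ⟨j, rfl⟩ := Nat.exists_eq_add_of_le' hk
    linear_combination (x ^ p ^ m) ^ j * b * h1
  have hpz2 : (p : A) * z ^ 2 = 0 := by
    linear_combination z * hpz + p * hmul 1 le_rfl + x ^ p ^ m * p * hq + x ^ (p ^ m - 1) * h1
  have hpow (k : ℕ) : z ^ (k + 2) = (x ^ p ^ m) ^ (k + 2) := by
    induction k with
    | zero => linear_combination z * hz + hmul 1 le_rfl + x * b * hpz + b * h1
    | succ k ih => rw [pow_succ z, show k + 1 + 1 = k + 2 from rfl, ih, hmul _ (by omega)]
  have hzp : z ^ p = 0 := by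
    obtain ⟨t, ht⟩ := Nat.exists_eq_add_of_le' hp.two_le
    rw [ht, hpow, ← ht, ← pow_mul]
    exact pow_eq_zero_of_le h h2
  rw [pow_succ, pow_mul, hb, one_pow, mul_one, add_assoc, ← hz,
    one_add_pow_prime_eq_of_mul_sq_eq_zero hp hpz2, hzp, hpz, add_zero]

/-- The noncommutative ring version of `one_add_pow_prime_pow_eq`. -/
theorem one_add_pow_prime_pow_eq_of_ring {A : Type*} [Ring A] {p m : ℕ} (hp : p.Prime)
    (h : 2 * p ^ m + 2 ≤ p ^ m * p) {x : A} (h0 : (p : A) ^ 2 = 0)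
    (h1 : p * x ^ (p ^ m + 1) = 0) (h2 : x ^ (2 * p ^ m + 2) = 0) :
    (1 + x) ^ p ^ (m + 1) = 1 + p * x ^ p ^ m := by
  let φ : Polynomial ℤ →+* A := (Polynomial.aeval x : Polynomial ℤ →ₐ[ℤ] A)
  have hinj := RingHom.kerLift_injective φ
  obtain ⟨y, hy⟩ : ∃ y, RingHom.kerLift φ y = x :=
    ⟨Ideal.Quotient.mk _ Polynomial.X, by simp [φ]⟩
  have := one_add_pow_prime_pow_eq hp h (x := y) (hinj (by simpa using h0))
    (hinj (by simpa [hy] using h1)) (hinj (by simpa [hy] using h2))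
  simpa [hy] using congrArg (RingHom.kerLift φ) this

theorem exists_matrix_pow_ne_zero_pow_succ_eq_zero (K : Type*) [Field K] (q : ℕ) :
    ∃ d, 1 ≤ d ∧ ∃ N : Matrix (Fin d) (Fin d) K, N ^ q ≠ 0 ∧ N ^ (q + 1) = 0 := by
  let g : Polynomial K := Polynomial.X ^ (q + 1)
  have hg : g.Monic := Polynomial.monic_X_pow _
  let b := (AdjoinRoot.powerBasis' hg).basis
  refine ⟨_, ?_, Algebra.leftMulMatrix b (AdjoinRoot.root g), ?_, ?_⟩
  · simp [g]
  · rw [← map_pow, Ne, map_eq_zero_iff _ (Algebra.leftMulMatrix_injective b), ← AdjoinRoot.mk_X,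
      ← map_pow, AdjoinRoot.mk_eq_zero, Polynomial.X_pow_dvd_iff]
    exact fun h => by simpa using h q (Nat.lt_succ_self q)
  · rw [← map_pow, ← AdjoinRoot.mk_X, ← map_pow, AdjoinRoot.mk_self, map_zero]

theorem exists_monoidHom_ofAdd_one_eq {G : Type*} [Group G] {n : ℕ} {u : G} (hu : u ^ n = 1) :
    ∃ f : Multiplicative (ZMod n) →* G, f (Multiplicative.ofAdd 1) = u :=
  ⟨AddMonoidHom.toMultiplicativeLeft
    (ZMod.lift n ⟨zmultiplesHom _ (Additive.ofMul u), by simp [← ofMul_pow, hu]⟩), by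
    have := ZMod.lift_coe n
      ⟨zmultiplesHom (Additive G) (Additive.ofMul u), by simp [← ofMul_pow, hu]⟩ 1
    simp at this
    simp [this]⟩

/-- for `p ≥ 3, n ≥ 2` or `p ≥ 5, n ≥ 1`, the cyclic group `ℤ/p^nℤ`
does not have property `L_p`. -/
theorem zmod_p_pow_not_hasLp (p n : ℕ) [Fact p.Prime]
    (h : (3 ≤ p ∧ 2 ≤ n) ∨ (5 ≤ p ∧ 1 ≤ n)) :
    ¬ HasLp p (Multiplicative (ZMod (p ^ n))) := by
  intro hL
  have hp : p.Prime := Fact.out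
  obtain ⟨m, rfl⟩ : ∃ m, n = m + 1 := ⟨n - 1, by omega⟩
  have hm : 2 * p ^ m + 2 ≤ p ^ m * p := by
    have h1 : 1 ≤ p ^ m := Nat.one_le_pow _ _ hp.pos
    rcases h with ⟨h3, h2⟩ | ⟨h5, -⟩
    · have : p ≤ p ^ m := Nat.le_self_pow (by omega) p
      nlinarith
    · nlinarith
  obtain ⟨d, hd, N, hN, hN'⟩ := exists_matrix_pow_ne_zero_pow_succ_eq_zero (ZMod p) (p ^ m)
  have : NeZero d := ⟨by omega⟩
  have hu : (1 + N) ^ p ^ (m + 1) = 1 := by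
    rw [add_pow_char_pow_of_commute _ _ (Commute.one_left N), one_pow,
      pow_eq_zero_of_le (by rw [pow_succ]; omega) hN', add_zero]
  let u : GL (Fin d) (ZMod p) := Units.ofPowEqOne _ _ hu (pow_ne_zero _ hp.ne_zero)
  obtain ⟨f, hf⟩ := exists_monoidHom_ofAdd_one_eq (u := u) (Units.pow_ofPowEqOne _ _)
  obtain ⟨g, hg⟩ := hL d hd (ZMod p) f
  let U : GL (Fin d) (TruncatedWittVector p 2 (ZMod p)) := g (Multiplicative.ofAdd 1)
  have hU : U.val ^ p ^ (m + 1) = 1 := by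
    rw [← Units.val_pow_eq_pow_val, ← map_pow, ← ofAdd_nsmul]
    simp
  let ρ := (wittReduce p (ZMod p)).mapMatrix (m := Fin d)
  have hρ : ρ U.val = 1 + N := by
    have := congrArg Units.val (DFunLike.congr_fun hg (Multiplicative.ofAdd 1))
    rw [hf] at this
    exact this
  let X := U.val - 1
  have hX : ρ X = N := by simp [X, hρ]
  have hpp : (p : Matrix (Fin d) (Fin d) (TruncatedWittVector p 2 (ZMod p))) ^ 2 = 0 := by
    have := congrArg (Matrix.scalar (Fin d))
      (natCast_sq_truncatedWittVector_two p (k := ZMod p))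
    rwa [map_pow, map_natCast, map_zero] at this
  have natCast_mul_apply (E : Matrix (Fin d) (Fin d) (TruncatedWittVector p 2 (ZMod p)))
      (i j : Fin d) :
      (p * E) i j = p * E i j := by
    rw [← nsmul_eq_mul, Matrix.smul_apply, nsmul_eq_mul]
  obtain ⟨E, hE⟩ : ∃ E, X ^ (p ^ m + 1) = p * E := by
    have hz : ρ (X ^ (p ^ m + 1)) = 0 := by rw [map_pow, hX, hN']
    choose e he using fun i j => exists_eq_natCast_mul_of_wittReduce_eq_zero
      (w := (X ^ (p ^ m + 1)) i j) (congrFun (congrFun hz i) j)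
    exact ⟨Matrix.of e, Matrix.ext fun i j => (he i j).trans (natCast_mul_apply _ i j).symm⟩
  have key := one_add_pow_prime_pow_eq_of_ring hp hm hpp
    (x := X) (by rw [hE, ← mul_assoc, ← sq, hpp, zero_mul])
    (by rw [show 2 * p ^ m + 2 = (p ^ m + 1) * 2 by ring, pow_mul, hE,
          (Nat.cast_commute p E).mul_pow, hpp, zero_mul])
  rw [add_sub_cancel, hU, left_eq_add] at key
  apply hN
  rw [← hX, ← map_pow]
  refine Matrix.ext fun i j => wittReduce_eq_zero_of_natCast_mul_eq_zero (k := ZMod p)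
    (w := (X ^ p ^ m) i j) ?_
  rw [← natCast_mul_apply, key, Matrix.zero_apply]
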